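/- arXiv:2311.08406 — 2 statements merged into one kernel-verified Lean document; each statement's English description precedes it below -/
import Mathlib

section
/- Let L₁ and L₂ be restrictable Hom-Lie ideals of a multiplicative Hom-Lie algebra (L,[.,.],α) over a field F of prime characteristic p such that L = L₁ + L₂ and [L₁,L₂] = {0}. Then L is restrictable. -/
namespace HomLiePaper

/-- The axioms of a Hom-Lie algebra over a field `F`: the bracket is bilinear and
skew-symmetric, the twist `α` is linear, and the Hom-Jacobi identity holds. -/
structure IsHomLie (F : Type*) {L : Type*} [Field F] [AddCommGroup L] [Module F L]
    (br : L → L → L) (α : L → L) : Prop where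
  add_left : ∀ x y z : L, br (x + y) z = br x z + br y z
  smul_left : ∀ (k : F) (x y : L), br (k • x) y = k • br x y
  add_right : ∀ x y z : L, br x (y + z) = br x y + br x z
  smul_right : ∀ (k : F) (x y : L), br x (k • y) = k • br x y
  skew : ∀ x y : L, br x y = - br y x
  alpha_linear : IsLinearMap F α
  jacobi : ∀ x y z : L, br (α x) (br y z) + br (α y) (br z x) + br (α z) (br x y) = 0

/-- Multiplicativity of the twist `α`. -/
def IsMult {L : Type*} (br : L → L → L) (α : L → L) : Prop :=
  ∀ x y : L, α (br x y) = br (α x) (α y)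

/-- `adPow br α x n = ad(α^[n-1] x) ∘ ad(α^[n-2] x) ∘ ⋯ ∘ ad(x)` (with `n` factors). -/
def adPow {L : Type*} (br : L → L → L) (α : L → L) (x : L) : ℕ → L → L
  | 0 => fun z => z
  | n + 1 => fun z => br (α^[n] x) (adPow br α x n z)

/-- `pm` is a `p`-structure on the Hom-Lie (sub)algebra carried by the subset `S` of `L`
(for the whole algebra take `S = Set.univ`): `pm` maps `S` into itself and satisfies
(R1) `ad(x^[p]) ∘ α^(p-1) = ad(α^(p-1) x) ∘ ⋯ ∘ ad(x)` on `S`,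
(R2) `(k • x)^[p] = k^p • x^[p]`, and
(R3) `(x+y)^[p] = x^[p] + y^[p] + ∑_{i=1}^{p-1} s_i(x,y)` where the `s_i(x,y)` are
determined by `ad(α^(p-2)(k•x+y)) ∘ ⋯ ∘ ad(k•x+y) (x) = ∑_{i=1}^{p-1} i k^(i-1) • s_i(x,y)`
for all `k : F`. -/
def IsPStructureOn (F : Type*) {L : Type*} [Field F] [AddCommGroup L] [Module F L]
    (p : ℕ) (br : L → L → L) (α : L → L) (S : Set L) (pm : L → L) : Prop :=
  (∀ x ∈ S, pm x ∈ S) ∧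
  (∀ x ∈ S, ∀ y ∈ S, br (pm x) (α^[p - 1] y) = adPow br α x p y) ∧
  (∀ x ∈ S, ∀ k : F, pm (k • x) = k ^ p • pm x) ∧
  (∀ x ∈ S, ∀ y ∈ S, ∃ s : ℕ → L,
    (∀ i ∈ Finset.Icc 1 (p - 1), s i ∈ S) ∧
    (∀ k : F, adPow br α (k • x + y) (p - 1) x
        = ∑ i ∈ Finset.Icc 1 (p - 1), ((i : F) * k ^ (i - 1)) • s i) ∧
    pm (x + y) = pm x + pm y + ∑ i ∈ Finset.Icc 1 (p - 1), s i)

/-- The Hom-Lie (sub)algebra carried by `S ⊆ L` is restrictable: for every `x ∈ S` there is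
`y ∈ S` with `ad(α^(p-1) x) ∘ ⋯ ∘ ad(x) = ad(y) ∘ α^(p-1)` as operators on `S`. -/
def RestrictableOn {L : Type*} (p : ℕ) (br : L → L → L) (α : L → L) (S : Set L) : Prop :=
  ∀ x ∈ S, ∃ y ∈ S, ∀ z ∈ S, adPow br α x p z = br y (α^[p - 1] z)

theorem iterate_mem {L : Type*} {α : L → L} {S : Set L} (hα : ∀ x ∈ S, α x ∈ S)
    (n : ℕ) {x : L} (hx : x ∈ S) : α^[n] x ∈ S :=
  Set.MapsTo.iterate (fun x hx => hα x hx) n hx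

theorem adPow_mem {L : Type*} {br : L → L → L} {α : L → L} {S : Set L}
    (hα : ∀ x ∈ S, α x ∈ S) (hbr : ∀ x ∈ S, ∀ y, br x y ∈ S) {x z : L}
    (hx : x ∈ S) (hz : z ∈ S) : ∀ n, adPow br α x n z ∈ S
  | 0 => hz
  | n + 1 => hbr _ (iterate_mem hα n hx) _

theorem IsHomLie.iterate_add {F L : Type*} [Field F] [AddCommGroup L] [Module F L]
    {br : L → L → L} {α : L → L} (h : IsHomLie F br α) (n : ℕ) (x y : L) :
    α^[n] (x + y) = α^[n] x + α^[n] y :=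
  iterate_map_add (h.alpha_linear.mk' α).toAddMonoidHom n x y

/-- The bracket is computed componentwise on sums from two commuting subsets. -/
theorem IsHomLie.bracket_add_of_commute {F L : Type*} [Field F] [AddCommGroup L] [Module F L]
    {br : L → L → L} {α : L → L} (h : IsHomLie F br α) {S T : Set L}
    (hcomm : ∀ x ∈ S, ∀ y ∈ T, br x y = 0) {x₁ x₂ z₁ z₂ : L}
    (hx₁ : x₁ ∈ S) (hx₂ : x₂ ∈ T) (hz₁ : z₁ ∈ S) (hz₂ : z₂ ∈ T) :
    br (x₁ + x₂) (z₁ + z₂) = br x₁ z₁ + br x₂ z₂ := by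
  rw [h.add_left, h.add_right, h.add_right, hcomm x₁ hx₁ z₂ hz₂, h.skew x₂ z₁,
    hcomm z₁ hz₁ x₂ hx₂]
  simp

theorem IsHomLie.adPow_add_of_commute {F L : Type*} [Field F] [AddCommGroup L] [Module F L]
    {br : L → L → L} {α : L → L} (h : IsHomLie F br α) {S T : Set L}
    (hSα : ∀ x ∈ S, α x ∈ S) (hSbr : ∀ x ∈ S, ∀ y, br x y ∈ S)
    (hTα : ∀ x ∈ T, α x ∈ T) (hTbr : ∀ x ∈ T, ∀ y, br x y ∈ T)
    (hcomm : ∀ x ∈ S, ∀ y ∈ T, br x y = 0) {x₁ x₂ z₁ z₂ : L}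
    (hx₁ : x₁ ∈ S) (hx₂ : x₂ ∈ T) (hz₁ : z₁ ∈ S) (hz₂ : z₂ ∈ T) (n : ℕ) :
    adPow br α (x₁ + x₂) n (z₁ + z₂) = adPow br α x₁ n z₁ + adPow br α x₂ n z₂ := by
  induction n with
  | zero => rfl
  | succ n ih =>
    simp only [adPow]
    rw [ih, h.iterate_add]
    exact h.bracket_add_of_commute hcomm (iterate_mem hSα n hx₁) (iterate_mem hTα n hx₂)
      (adPow_mem hSα hSbr hx₁ hz₁ n) (adPow_mem hTα hTbr hx₂ hz₂ n)

/-- If `L = L₁ + L₂` for restrictable Hom-Lie ideals `L₁, L₂` with `[L₁, L₂] = 0`, then `L`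
is restrictable. -/
theorem restrictable_of_sum_commuting_ideals {F L : Type*} [Field F]
    [AddCommGroup L] [Module F L]
    (p : ℕ) (hp : p.Prime) [CharP F p]
    (br : L → L → L) (α : L → L)
    (hHL : IsHomLie F br α) (hM : IsMult br α)
    (L₁ L₂ : Submodule F L)
    (h1α : ∀ x ∈ L₁, α x ∈ L₁) (h1br : ∀ x ∈ L₁, ∀ y : L, br x y ∈ L₁)
    (h2α : ∀ x ∈ L₂, α x ∈ L₂) (h2br : ∀ x ∈ L₂, ∀ y : L, br x y ∈ L₂)
    (hsum : L₁ ⊔ L₂ = ⊤)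
    (hcomm : ∀ x ∈ L₁, ∀ y ∈ L₂, br x y = 0)
    (h1res : RestrictableOn p br α (L₁ : Set L))
    (h2res : RestrictableOn p br α (L₂ : Set L)) :
    RestrictableOn p br α Set.univ := by
  have decomp : ∀ v : L, ∃ v₁ ∈ L₁, ∃ v₂ ∈ L₂, v₁ + v₂ = v := fun v =>
    Submodule.mem_sup.1 (hsum ▸ Submodule.mem_top)
  intro x _
  obtain ⟨x₁, hx₁, x₂, hx₂, rfl⟩ := decomp x
  obtain ⟨y₁, hy₁, h₁⟩ := h1res x₁ hx₁
  obtain ⟨y₂, hy₂, h₂⟩ := h2res x₂ hx₂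
  refine ⟨y₁ + y₂, Set.mem_univ _, fun z _ => ?_⟩
  obtain ⟨z₁, hz₁, z₂, hz₂, rfl⟩ := decomp z
  rw [hHL.adPow_add_of_commute (S := L₁) (T := L₂) h1α h1br h2α h2br hcomm hx₁ hx₂ hz₁ hz₂,
    hHL.iterate_add, hHL.bracket_add_of_commute (S := L₁) (T := L₂) hcomm hy₁ hy₂
      (iterate_mem h1α _ hz₁) (iterate_mem h2α _ hz₂), h₁ z₁ hz₁, h₂ z₂ hz₂]
end HomLiePaper
end

section
/- Let (L,[.,.]_L,α_L) be a finite-dimensional involutive Hom-Lie algebra over a field F of prime characteristic p and let (G,[.,.]_G,α_G,[p],i) be a finite-dimensional p-envelope of L. Then G is a minimal p-envelope of L if and only if C(G) ⊆ i(L), where C(G) = {x ∈ G | [x,α_G^{p-1}(y)]_G = 0 for all y ∈ G} is the α_G^{p-1}-center of G. -/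
namespace HomLiePaper

universe u v

/-- `(G, brG, αG, pm, i)` is a `p`-envelope of the Hom-Lie algebra `(L, brL, αL)`:
`G` is a restricted Hom-Lie algebra, `i : L → G` is an injective morphism of Hom-Lie
algebras, and the smallest `p`-subalgebra of `G` containing `i(L)` is `G` itself. -/
def IsPEnvelope (F : Type*) [Field F] {L : Type v} {G : Type u}
    [AddCommGroup L] [Module F L] [AddCommGroup G] [Module F G]
    (p : ℕ) (brL : L → L → L) (αL : L → L)
    (brG : G → G → G) (αG : G → G) (pm : G → G) (i : L → G) : Prop :=
  IsHomLie F brG αG ∧ IsMult brG αG ∧ IsPStructureOn F p brG αG Set.univ pm ∧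
  IsLinearMap F i ∧ Function.Injective i ∧
  (∀ x y : L, i (brL x y) = brG (i x) (i y)) ∧ (∀ x : L, i (αL x) = αG (i x)) ∧
  (∀ H : Submodule F G, (∀ x ∈ H, αG x ∈ H) → (∀ x ∈ H, ∀ y ∈ H, brG x y ∈ H) →
    (∀ x ∈ H, pm x ∈ H) → (∀ x : L, i x ∈ H) → H = ⊤)

/-- A `p`-envelope is minimal if its dimension is minimal among (the dimensions of) all
`p`-envelopes of `L`. -/
def IsMinimalPEnvelope (F : Type*) [Field F] {L : Type v} {G : Type u}
    [AddCommGroup L] [Module F L] [AddCommGroup G] [Module F G]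
    (p : ℕ) (brL : L → L → L) (αL : L → L)
    (brG : G → G → G) (αG : G → G) (pm : G → G) (i : L → G) : Prop :=
  IsPEnvelope F p brL αL brG αG pm i ∧
  ∀ (G' : Type u) [AddCommGroup G'] [Module F G']
    (brG' : G' → G' → G') (αG' : G' → G') (pm' : G' → G') (i' : L → G'),
    IsPEnvelope F p brL αL brG' αG' pm' i' → Module.rank F G ≤ Module.rank F G'

lemma adPow_succ {G : Type*} (br : G → G → G) (α : G → G) (x : G) (n : ℕ) (y : G) :
    adPow br α x (n + 1) y = br (α^[n] x) (adPow br α x n y) := rfl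

lemma IsMult.iterate {G : Type*} {br : G → G → G} {α : G → G} (hm : IsMult br α)
    (n : ℕ) (x y : G) :
    α^[n] (br x y) = br (α^[n] x) (α^[n] y) := by
  induction n with
  | zero => rfl
  | succ n ih => simp only [Function.iterate_succ_apply', ih, hm _ _]

lemma iterate_iterate_of_involutive {L : Type*} {αL : L → L} (hinv : ∀ x, αL (αL x) = x)
    (n : ℕ) (x : L) : αL^[n] (αL^[n] x) = x :=
  Function.LeftInverse.iterate hinv n x

/-- The operator `x ↦ f_{n-1} (⋯ (f_0 x))` with `f_j` the conjugate of `f` by the `j`-th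
iterate of the involution `αL`. -/
def twistedPow {L : Type*} (αL f : L → L) : ℕ → L → L
  | 0 => id
  | n + 1 => fun x => αL^[n] (f (αL^[n] (twistedPow αL f n x)))

lemma twistedPow_succ {L : Type*} (αL f : L → L) (n : ℕ) (x : L) :
    twistedPow αL f (n + 1) x = αL^[n] (f (αL^[n] (twistedPow αL f n x))) := rfl

section Restricted

variable {F : Type*} [Field F] {G : Type*} [AddCommGroup G] [Module F G]
  {br : G → G → G} {α : G → G} {p : ℕ}

/-- The bracket of a Hom-Lie algebra as a bilinear map. -/
def IsHomLie.bracket (h : IsHomLie F br α) : G →ₗ[F] G →ₗ[F] G :=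
  LinearMap.mk₂ F br h.add_left h.smul_left h.add_right h.smul_right

/-- The twist of a Hom-Lie algebra as a linear map. -/
def IsHomLie.twist (h : IsHomLie F br α) : G →ₗ[F] G := h.alpha_linear.mk' α

lemma IsHomLie.twist_pow_apply (h : IsHomLie F br α) (n : ℕ) (x : G) :
    (h.twist ^ n) x = α^[n] x := Module.End.pow_apply _ _ _

lemma IsHomLie.zero_left (h : IsHomLie F br α) (y : G) : br 0 y = 0 :=
  h.bracket.map_zero₂ y

lemma IsHomLie.zero_right (h : IsHomLie F br α) (x : G) : br x 0 = 0 :=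
  (h.bracket x).map_zero

lemma IsHomLie.sub_left (h : IsHomLie F br α) (x y z : G) :
    br (x - y) z = br x z - br y z :=
  h.bracket.map_sub₂ x y z

lemma IsHomLie.sub_right (h : IsHomLie F br α) (x y z : G) :
    br x (y - z) = br x y - br x z :=
  (h.bracket x).map_sub y z

lemma IsHomLie.neg_right (h : IsHomLie F br α) (x y : G) : br x (-y) = -br x y :=
  (h.bracket x).map_neg y

lemma IsHomLie.bracket_bracket_twist (h : IsHomLie F br α) (x y z : G) :
    br (br x y) (α z) = br (α x) (br y z) - br (α y) (br x z) := by
  have h1 := h.jacobi x y z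
  rw [h.skew (α z), h.skew z x, h.neg_right] at h1
  rw [← sub_eq_zero, ← neg_eq_zero, ← h1]
  abel

/-- The elements of `G` whose adjoint operator maps `T` into `U`. -/
def IsHomLie.transporter (h : IsHomLie F br α) (T U : Submodule F G) : Submodule F G where
  carrier := {g | ∀ z ∈ T, br g z ∈ U}
  zero_mem' z _ := by rw [h.zero_left]; exact U.zero_mem
  add_mem' ha hb z hz := by rw [h.add_left]; exact U.add_mem (ha z hz) (hb z hz)
  smul_mem' k _ ha z hz := by rw [h.smul_left]; exact U.smul_mem k (ha z hz)

/-- `H` is a `p`-subalgebra with respect to the given operations. -/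
def IsPSubalgebra (br : G → G → G) (α pm : G → G) (H : Submodule F G) : Prop :=
  (∀ x ∈ H, α x ∈ H) ∧ (∀ x ∈ H, ∀ y ∈ H, br x y ∈ H) ∧ ∀ x ∈ H, pm x ∈ H

lemma iterate_mem_s19 {H : Submodule F G} (hH : ∀ x ∈ H, α x ∈ H) (n : ℕ) {x : G} (hx : x ∈ H) :
    α^[n] x ∈ H := by
  induction n with
  | zero => exact hx
  | succ n ih => rw [Function.iterate_succ_apply']; exact hH _ ih

lemma exists_iterate_eq {T : Submodule F G} (hT : ∀ z ∈ T, ∃ w ∈ T, α w = z) (n : ℕ) :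
    ∀ z ∈ T, ∃ w ∈ T, α^[n] w = z := by
  induction n with
  | zero => exact fun z hz => ⟨z, hz, rfl⟩
  | succ n ih =>
    intro z hz
    obtain ⟨w, hw, rfl⟩ := ih z hz
    obtain ⟨v, hv, rfl⟩ := hT w hw
    exact ⟨v, hv, rfl⟩

lemma IsHomLie.isPSubalgebra_transporter (h : IsHomLie F br α) (hm : IsMult br α) (hp : 0 < p)
    {pm : G → G} (hpm : IsPStructureOn F p br α Set.univ pm) {T U : Submodule F G}
    (hT : ∀ z ∈ T, ∃ w ∈ T, α w = z) (hU : ∀ u ∈ U, α u ∈ U)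
    (hTU : ∀ g ∈ h.transporter T U, ∀ u ∈ U, br g u ∈ U) :
    IsPSubalgebra br α pm (h.transporter T U) := by
  have hα : ∀ x ∈ h.transporter T U, α x ∈ h.transporter T U := by
    intro x hx z hz
    obtain ⟨w, hw, rfl⟩ := hT z hz
    rw [← hm]
    exact hU _ (hx w hw)
  refine ⟨hα, fun x hx y hy z hz => ?_, fun x hx z hz => ?_⟩
  · obtain ⟨w, hw, rfl⟩ := hT z hz
    rw [h.bracket_bracket_twist]
    exact U.sub_mem (hTU _ (hα x hx) _ (hy w hw)) (hTU _ (hα y hy) _ (hx w hw))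
  · obtain ⟨w, hw, rfl⟩ := exists_iterate_eq hT (p - 1) z hz
    rw [hpm.2.1 x trivial w trivial]
    obtain ⟨n, rfl⟩ : ∃ n, p = n + 1 := ⟨p - 1, by omega⟩
    clear hpm hp hz
    induction n with
    | zero => exact hx w hw
    | succ n ih => exact hTU _ (iterate_mem_s19 hα _ hx) _ ih

end Restricted

section Envelope

variable {F : Type*} [Field F] {L : Type v} {G : Type u}
  [AddCommGroup L] [Module F L] [AddCommGroup G] [Module F G] {p : ℕ}
  {brL : L → L → L} {αL : L → L} {br : G → G → G} {α : G → G} {pm : G → G} {i : L → G}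

/-- The image of `L` in a `p`-envelope, as a submodule. -/
def IsPEnvelope.image (e : IsPEnvelope F p brL αL br α pm i) : Submodule F G :=
  LinearMap.range (e.2.2.2.1.mk' i)

lemma IsPEnvelope.mem_of_isPSubalgebra (e : IsPEnvelope F p brL αL br α pm i)
    {H : Submodule F G} (hH : IsPSubalgebra br α pm H) (hi : ∀ x, i x ∈ H) (g : G) : g ∈ H := by
  rw [e.2.2.2.2.2.2.2 H hH.1 hH.2.1 hH.2.2 hi]
  trivial

lemma IsPEnvelope.bracket_mem (e : IsPEnvelope F p brL αL br α pm i) (hp : 0 < p)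
    {T U : Submodule F G} (hT : ∀ z ∈ T, ∃ w ∈ T, α w = z) (hU : ∀ u ∈ U, α u ∈ U)
    (hTU : ∀ g, (∀ z ∈ T, br g z ∈ U) → ∀ u ∈ U, br g u ∈ U)
    (hi : ∀ x, ∀ z ∈ T, br (i x) z ∈ U) (g : G) : ∀ z ∈ T, br g z ∈ U :=
  e.mem_of_isPSubalgebra (e.1.isPSubalgebra_transporter e.2.1 hp e.2.2.1 hT hU hTU) hi g

lemma IsPEnvelope.twist_mem_image (e : IsPEnvelope F p brL αL br α pm i) :
    ∀ u ∈ e.image, α u ∈ e.image := by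
  rintro _ ⟨x, rfl⟩
  exact ⟨αL x, e.2.2.2.2.2.2.1 x⟩

lemma IsPEnvelope.exists_twist_eq (e : IsPEnvelope F p brL αL br α pm i)
    (hinv : ∀ x, αL (αL x) = x) : ∀ z ∈ e.image, ∃ w ∈ e.image, α w = z := by
  rintro _ ⟨x, rfl⟩
  exact ⟨i (αL x), ⟨αL x, rfl⟩, by rw [← e.2.2.2.2.2.2.1, hinv]; rfl⟩

lemma IsPEnvelope.bracket_mem_image (e : IsPEnvelope F p brL αL br α pm i) (hp : 0 < p)
    (hinv : ∀ x, αL (αL x) = x) (g : G) : ∀ z ∈ e.image, br g z ∈ e.image := by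
  refine e.bracket_mem hp (e.exists_twist_eq hinv) e.twist_mem_image (fun _ h => h) ?_ g
  rintro x _ ⟨y, rfl⟩
  exact ⟨brL x y, e.2.2.2.2.2.1 x y⟩

lemma IsPEnvelope.iterate_comm (e : IsPEnvelope F p brL αL br α pm i) (n : ℕ) (x : L) :
    i (αL^[n] x) = α^[n] (i x) := by
  induction n with
  | zero => rfl
  | succ n ih => rw [Function.iterate_succ_apply', Function.iterate_succ_apply', ← ih,
      e.2.2.2.2.2.2.1]

/-- The adjoint action of a `p`-envelope on `L`. -/
lemma IsPEnvelope.exists_adjoint (e : IsPEnvelope F p brL αL br α pm i) (hp : 0 < p)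
    (hinv : ∀ x, αL (αL x) = x) :
    ∃ ρ : G →ₗ[F] (L → L), ∀ g x, i (ρ g x) = br g (i x) := by
  obtain ⟨s, hs⟩ := (e.2.2.2.1.mk' i).exists_leftInverse_of_injective
    (LinearMap.ker_eq_bot.2 e.2.2.2.2.1)
  refine ⟨LinearMap.pi fun x => s ∘ₗ e.1.bracket.flip (i x), fun g x => ?_⟩
  obtain ⟨y, hy⟩ := e.bracket_mem_image hp hinv g (i x) ⟨x, rfl⟩
  change i (s (br g (i x))) = _
  rw [← hy]
  exact congrArg i (LinearMap.congr_fun hs y)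

section Adjoint

variable (e : IsPEnvelope F p brL αL br α pm i) (hinv : ∀ x, αL (αL x) = x)
  {ρ : G →ₗ[F] (L → L)} (hρ : ∀ g x, i (ρ g x) = br g (i x))

include e hρ

lemma IsPEnvelope.adjoint_image (x : L) : ρ (i x) = brL x := by
  ext y
  apply e.2.2.2.2.1
  rw [hρ, e.2.2.2.2.2.1]

lemma IsPEnvelope.adjoint_eq_zero_iff {g : G} : ρ g = 0 ↔ ∀ z ∈ e.image, br g z = 0 := by
  constructor
  · rintro h _ ⟨x, rfl⟩
    change br g (i x) = 0
    rw [← hρ, h]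
    exact e.2.2.2.1.map_zero
  · intro h
    ext x
    apply e.2.2.2.2.1
    exact (hρ g x).trans ((h _ ⟨x, rfl⟩).trans e.2.2.2.1.map_zero.symm)

include hinv

lemma IsPEnvelope.adjoint_twist_iterate (n : ℕ) (g : G) (x : L) :
    ρ (α^[n] g) x = αL^[n] (ρ g (αL^[n] x)) := by
  apply e.2.2.2.2.1
  rw [hρ, e.iterate_comm, hρ, e.2.1.iterate, ← e.iterate_comm,
    iterate_iterate_of_involutive hinv]

lemma IsPEnvelope.adjoint_bracket (g h : G) (x : L) :
    ρ (br g h) x = ρ (α g) (ρ h (αL x)) - ρ (α h) (ρ g (αL x)) := by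
  apply e.2.2.2.2.1
  rw [hρ, e.2.2.2.1.map_sub, hρ, hρ, hρ, hρ, ← e.1.bracket_bracket_twist,
    ← e.2.2.2.2.2.2.1, hinv]

lemma IsPEnvelope.adjoint_pmap (g : G) (x : L) :
    ρ (pm g) x = twistedPow αL (ρ g) p (αL^[p - 1] x) := by
  have key : ∀ (n : ℕ) (y : L), i (twistedPow αL (ρ g) n y) = adPow br α g n (i y) := by
    intro n
    induction n with
    | zero => exact fun y => rfl
    | succ n ih =>
      intro y
      rw [twistedPow_succ, ← e.adjoint_twist_iterate hinv hρ, hρ, ih, adPow_succ]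
  apply e.2.2.2.2.1
  rw [hρ, key, ← e.2.2.1.2.1 g trivial _ trivial, ← e.iterate_comm,
    iterate_iterate_of_involutive hinv]

end Adjoint

/-- The range of the adjoint action on `L` is the same for all `p`-envelopes. -/
lemma IsPEnvelope.range_adjoint_le {G' : Type*} [AddCommGroup G'] [Module F G']
    {br' : G' → G' → G'} {α' : G' → G'} {pm' : G' → G'} {i' : L → G'}
    (e : IsPEnvelope F p brL αL br α pm i) (e' : IsPEnvelope F p brL αL br' α' pm' i')
    (hinv : ∀ x, αL (αL x) = x)
    {ρ : G →ₗ[F] (L → L)} (hρ : ∀ g x, i (ρ g x) = br g (i x))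
    {ρ' : G' →ₗ[F] (L → L)} (hρ' : ∀ g x, i' (ρ' g x) = br' g (i' x)) :
    LinearMap.range ρ ≤ LinearMap.range ρ' := by
  have htw : ∀ (x : G) (x' : G'), ρ' x' = ρ x → ρ' (α' x') = ρ (α x) := by
    intro x x' hx
    ext y
    have h1 := e.adjoint_twist_iterate hinv hρ 1 x y
    have h2 := e'.adjoint_twist_iterate hinv hρ' 1 x' y
    rw [hx, ← h1] at h2
    exact h2
  rintro _ ⟨g, rfl⟩
  refine e.mem_of_isPSubalgebra (H := (LinearMap.range ρ').comap ρ) ⟨?_, ?_, ?_⟩ ?_ g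
  · rintro x ⟨x', hx⟩
    exact ⟨α' x', htw x x' hx⟩
  · rintro x ⟨x', hx⟩ y ⟨y', hy⟩
    refine ⟨br' x' y', ?_⟩
    ext z
    rw [e.adjoint_bracket hinv hρ, e'.adjoint_bracket hinv hρ', htw x x' hx, htw y y' hy, hx, hy]
  · rintro x ⟨x', hx⟩
    refine ⟨pm' x', ?_⟩
    ext z
    rw [e.adjoint_pmap hinv hρ, e'.adjoint_pmap hinv hρ', hx]
  · intro x
    exact ⟨i' x, (e'.adjoint_image hρ' x).trans (e.adjoint_image hρ x).symm⟩

/-- If the kernel of the adjoint action on `L` lies in `L`, the `p`-envelope has the smallest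
possible dimension. -/
lemma IsPEnvelope.rank_le {G' : Type u} [AddCommGroup G'] [Module F G']
    {br' : G' → G' → G'} {α' : G' → G'} {pm' : G' → G'} {i' : L → G'}
    (e : IsPEnvelope F p brL αL br α pm i) (e' : IsPEnvelope F p brL αL br' α' pm' i')
    (hp : 0 < p) (hinv : ∀ x, αL (αL x) = x)
    (hker : ∀ g, (∀ z ∈ e.image, br g z = 0) → g ∈ e.image) :
    Module.rank F G ≤ Module.rank F G' := by
  obtain ⟨ρ, hρ⟩ := e.exists_adjoint hp hinv
  obtain ⟨ρ', hρ'⟩ := e'.exists_adjoint hp hinv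
  obtain ⟨s, hs⟩ := (e.2.2.2.1.mk' i).exists_leftInverse_of_injective
    (LinearMap.ker_eq_bot.2 e.2.2.2.2.1)
  have his : ∀ g ∈ LinearMap.ker ρ, i (s g) = g := by
    intro g hg
    obtain ⟨x, rfl⟩ := hker g ((e.adjoint_eq_zero_iff hρ).1 hg)
    exact congrArg i (LinearMap.congr_fun hs x)
  let φ : LinearMap.ker ρ →ₗ[F] LinearMap.ker ρ' :=
    ((e'.2.2.2.1.mk' i') ∘ₗ s ∘ₗ (LinearMap.ker ρ).subtype).codRestrict _ (by
      rintro ⟨g, hg⟩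
      have h1 : ρ' (i' (s g)) = 0 := by
        rw [e'.adjoint_image hρ', ← e.adjoint_image hρ, his g hg, hg]
      exact h1)
  have hφ : Function.Injective φ := by
    rintro ⟨g, hg⟩ ⟨h, hh⟩ hgh
    have h1 : s g = s h := e'.2.2.2.2.1 (congrArg Subtype.val hgh)
    exact Subtype.ext ((his g hg).symm.trans ((congrArg i h1).trans (his h hh)))
  let ψ : (G ⧸ LinearMap.ker ρ) →ₗ[F] (G' ⧸ LinearMap.ker ρ') :=
    ρ'.quotKerEquivRange.symm.toLinearMap ∘ₗ
      Submodule.inclusion (e.range_adjoint_le e' hinv hρ hρ') ∘ₗ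
      ρ.quotKerEquivRange.toLinearMap
  have hψ : Function.Injective ψ :=
    ρ'.quotKerEquivRange.symm.injective.comp
      ((Submodule.inclusion_injective (e.range_adjoint_le e' hinv hρ hρ')).comp
        ρ.quotKerEquivRange.injective)
  rw [← Submodule.rank_quotient_add_rank (LinearMap.ker ρ),
    ← Submodule.rank_quotient_add_rank (LinearMap.ker ρ')]
  exact add_le_add (ψ.rank_le_of_injective hψ) (φ.rank_le_of_injective hφ)

/-- A Fitting decomposition of a `p`-envelope with respect to the twist. -/
lemma IsPEnvelope.exists_fitting [FiniteDimensional F G]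
    (e : IsPEnvelope F p brL αL br α pm i) (hp : 0 < p) (hinv : ∀ x, αL (αL x) = x) :
    ∃ n, (∀ x, α x = 0 → α^[n] x = 0) ∧
      (∀ x ∈ e.image, α^[n] x = 0 → x = 0) ∧
      (∀ x y, br x (α^[n] y) ∈ e.image) ∧
      ∀ k, (∀ z ∈ e.image, br k z = 0) → ∀ x, α^[n] (br k x) = 0 := by
  obtain ⟨n, hn, hcompl⟩ : ∃ n, 1 ≤ n ∧
      IsCompl (LinearMap.ker (e.1.twist ^ n)) (LinearMap.range (e.1.twist ^ n)) :=
    ((Filter.eventually_ge_atTop 1).and e.1.twist.eventually_isCompl_ker_pow_range_pow).exists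
  have hzero : ∀ x, α x = 0 → α^[n] x = 0 := by
    intro x hx
    obtain ⟨m, rfl⟩ : ∃ m, n = m + 1 := ⟨n - 1, by omega⟩
    rw [Function.iterate_succ_apply, hx, ← e.1.twist_pow_apply, map_zero]
  have hstab : ∀ z ∈ LinearMap.range (e.1.twist ^ n), α z ∈ LinearMap.range (e.1.twist ^ n) := by
    rintro _ ⟨y, rfl⟩
    refine ⟨α y, ?_⟩
    rw [e.1.twist_pow_apply, e.1.twist_pow_apply, ← Function.iterate_succ_apply,
      Function.iterate_succ_apply']
  have hsurj : ∀ T ≤ LinearMap.range (e.1.twist ^ n), (∀ z ∈ T, α z ∈ T) →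
      ∀ z ∈ T, ∃ w ∈ T, α w = z := by
    intro T hT hTα z hz
    have hinj : Function.Injective (e.1.twist.restrict hTα) := by
      rw [← LinearMap.ker_eq_bot, LinearMap.ker_eq_bot']
      rintro ⟨w, hw⟩ h0
      have h1 : α w = 0 := congrArg Subtype.val h0
      have h2 : w ∈ LinearMap.ker (e.1.twist ^ n) := by
        rw [LinearMap.mem_ker, e.1.twist_pow_apply, hzero w h1]
      exact Subtype.ext (Submodule.disjoint_def.1 hcompl.disjoint w h2 (hT hw))
    obtain ⟨⟨w, hw⟩, hwz⟩ := LinearMap.injective_iff_surjective.1 hinj ⟨z, hz⟩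
    exact ⟨w, hw, congrArg Subtype.val hwz⟩
  refine ⟨n, hzero, ?_, ?_, ?_⟩
  · rintro _ ⟨x, rfl⟩ hx
    change α^[n] (i x) = 0 at hx
    rw [← e.iterate_comm, ← e.2.2.2.1.map_zero] at hx
    have h1 := congrArg αL^[n] (e.2.2.2.2.1 hx)
    rw [iterate_iterate_of_involutive hinv] at h1
    have h2 : αL^[n] 0 = 0 := by
      apply e.2.2.2.2.1
      rw [e.iterate_comm, e.2.2.2.1.map_zero, ← e.1.twist_pow_apply, map_zero]
    rw [h1, h2, map_zero]
  · intro x y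
    refine e.bracket_mem hp (T := LinearMap.range (e.1.twist ^ n)) (hsurj _ le_rfl hstab)
      e.twist_mem_image (fun g _ => e.bracket_mem_image hp hinv g) ?_ x _
      ⟨y, e.1.twist_pow_apply n y⟩
    intro x z _
    rw [e.1.skew]
    exact e.image.neg_mem (e.bracket_mem_image hp hinv z _ ⟨x, rfl⟩)
  · intro k hk x
    have hK : ∀ k ∈ e.1.transporter e.image ⊥, α k ∈ e.1.transporter e.image ⊥ := by
      intro k hk z hz
      obtain ⟨w, hw, rfl⟩ := e.exists_twist_eq hinv z hz
      rw [← e.2.1, (Submodule.mem_bot F).1 (hk w hw)]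
      exact e.1.twist.map_zero
    have hmem : k ∈ e.1.transporter e.image ⊥ := fun z hz => (Submodule.mem_bot F).2 (hk z hz)
    have := e.bracket_mem hp (U := ⊥)
      (T := LinearMap.range (e.1.twist ^ n) ⊓ e.1.transporter e.image ⊥)
      (hsurj _ inf_le_left fun z hz => ⟨hstab z hz.1, hK z hz.2⟩)
      (by rintro u rfl; exact e.1.twist.map_zero)
      (by rintro g - u rfl; exact e.1.zero_right g)
      (fun x z hz => by
        rw [e.1.skew, (Submodule.mem_bot F).1 (hz.2 (i x) ⟨x, rfl⟩), neg_zero]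
        exact Submodule.zero_mem _)
      (α^[n] x) (α^[n] k) ⟨⟨k, e.1.twist_pow_apply n k⟩, iterate_mem_s19 hK n hmem⟩
    rw [e.2.1.iterate, e.1.skew, (Submodule.mem_bot F).1 this, neg_zero]

/-- If the `α^(p-1)`-center lies in `L`, so does the centralizer of `L`. -/
lemma IsPEnvelope.centralizer_le_of_center_le [FiniteDimensional F G]
    (e : IsPEnvelope F p brL αL br α pm i) (hp : 1 < p) (hinv : ∀ x, αL (αL x) = x)
    (hC : ∀ x, (∀ y, br x (α^[p - 1] y) = 0) → x ∈ e.image) (g : G)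
    (hg : ∀ z ∈ e.image, br g z = 0) : g ∈ e.image := by
  obtain ⟨n, hzero, himage, hbr, hcent⟩ := e.exists_fitting (by omega) hinv
  have hC' : ∀ x, α x = 0 → (∀ y, br x (α y) = 0) → x = 0 := by
    intro x hx hxy
    refine himage x (hC x fun y => ?_) (hzero x hx)
    obtain ⟨m, hm⟩ : ∃ m, p - 1 = m + 1 := ⟨p - 2, by omega⟩
    rw [hm, Function.iterate_succ_apply', hxy]
  have hker : ∀ x y, α x = 0 → α (br x y) = 0 := by
    intro x y hx
    rw [e.2.1, hx, e.1.zero_left]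
  have hcomm : ∀ j ≤ n, ∀ x y, α x = 0 → br x (α^[j] y) = 0 := by
    intro j hj
    induction hj using Nat.decreasingInduction with
    | self =>
      intro x y hx
      exact himage _ (hbr x y) (hzero _ (hker x _ hx))
    | of_succ j hj ih =>
      intro x y hx
      refine hC' _ (hker x _ hx) fun z => ?_
      rw [e.1.bracket_bracket_twist, hx, e.1.zero_left, e.1.skew,
        ← Function.iterate_succ_apply' α, ih _ _ (hker x z hx), neg_zero, sub_zero]
  have hinj : ∀ x, α x = 0 → x = 0 := fun x hx =>
    hC' x hx fun y => hcomm 0 (Nat.zero_le n) x (α y) hx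
  have hinjn : ∀ m x, α^[m] x = 0 → x = 0 := by
    intro m
    induction m with
    | zero => exact fun x hx => hx
    | succ m ih => exact fun x hx => hinj x (ih _ hx)
  exact hC g fun y => hinjn n _ (hcent g hg _)

/-- A restricted Hom-Lie algebra containing `L` contains a `p`-envelope of `L`, inside any
`p`-subalgebra `S` containing `L`. -/
lemma exists_isPEnvelope_le (h : IsHomLie F br α) (hm : IsMult br α)
    (hpm : IsPStructureOn F p br α Set.univ pm) (hi : IsLinearMap F i)
    (hinj : Function.Injective i) (hbr : ∀ x y, i (brL x y) = br (i x) (i y))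
    (hα : ∀ x, i (αL x) = α (i x)) {S : Submodule F G} (hS : IsPSubalgebra br α pm S)
    (hiS : ∀ x, i x ∈ S) :
    ∃ H ≤ S, ∃ (brH : H → H → H) (αH pmH : H → H) (iH : L → H),
      IsPEnvelope F p brL αL brH αH pmH iH := by
  let H : Submodule F G := sInf {H | IsPSubalgebra br α pm H ∧ ∀ x, i x ∈ H}
  have hHle : ∀ K : Submodule F G, IsPSubalgebra br α pm K → (∀ x, i x ∈ K) → H ≤ K :=
    fun K hK hiK => sInf_le ⟨hK, hiK⟩
  have hiH : ∀ x, i x ∈ H := fun x => (Submodule.mem_sInf).2 fun K hK => hK.2 x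
  have hH : IsPSubalgebra br α pm H :=
    ⟨fun x hx => Submodule.mem_sInf.2 fun K hK => hK.1.1 x (Submodule.mem_sInf.1 hx K hK),
      fun x hx y hy => Submodule.mem_sInf.2 fun K hK =>
        hK.1.2.1 x (Submodule.mem_sInf.1 hx K hK) y (Submodule.mem_sInf.1 hy K hK),
      fun x hx => Submodule.mem_sInf.2 fun K hK => hK.1.2.2 x (Submodule.mem_sInf.1 hx K hK)⟩
  clear_value H
  let brH : H → H → H := fun x y => ⟨br x y, hH.2.1 x x.2 y y.2⟩
  let αH : H → H := fun x => ⟨α x, hH.1 x x.2⟩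
  let pmH : H → H := fun x => ⟨pm x, hH.2.2 x x.2⟩
  have hiter : ∀ (n : ℕ) (x : H), ((αH^[n] x : H) : G) = α^[n] x := by
    intro n x
    induction n with
    | zero => rfl
    | succ n ih => rw [Function.iterate_succ_apply', Function.iterate_succ_apply', ← ih]
  have hadPow : ∀ (n : ℕ) (x y : H), ((adPow brH αH x n y : H) : G) = adPow br α x n y := by
    intro n x y
    induction n with
    | zero => rfl
    | succ n ih =>
      rw [adPow_succ, adPow_succ, ← ih, ← hiter]
  obtain ⟨π, hπ⟩ := H.subtype.exists_leftInverse_of_injective (Submodule.ker_subtype H)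
  have hπ' : ∀ x : H, π x = x := LinearMap.congr_fun hπ
  refine ⟨H, hHle S hS hiS, brH, αH, pmH, fun x => ⟨i x, hiH x⟩, ?_, ?_, ⟨?_, ?_, ?_, ?_⟩,
    ?_, ?_, ?_, ?_, ?_⟩
  · exact
      { add_left := fun x y z => Subtype.ext (h.add_left x y z)
        smul_left := fun k x y => Subtype.ext (h.smul_left k x y)
        add_right := fun x y z => Subtype.ext (h.add_right x y z)
        smul_right := fun k x y => Subtype.ext (h.smul_right k x y)
        skew := fun x y => Subtype.ext (h.skew x y)
        alpha_linear := ⟨fun x y => Subtype.ext (h.alpha_linear.map_add x y),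
          fun k x => Subtype.ext (h.alpha_linear.map_smul k x)⟩
        jacobi := fun x y z => Subtype.ext (h.jacobi x y z) }
  · exact fun x y => Subtype.ext (hm x y)
  · exact fun _ _ => trivial
  · intro x _ y _
    apply Subtype.ext
    rw [hadPow, ← hpm.2.1 x trivial y trivial, ← hiter]
  · exact fun x _ k => Subtype.ext (hpm.2.2.1 x trivial k)
  · intro x _ y _
    obtain ⟨s, -, hs, hsum⟩ := hpm.2.2.2 x trivial y trivial
    refine ⟨fun j => π (s j), fun _ _ => trivial, fun k => ?_, ?_⟩
    · rw [← hπ' (adPow brH αH (k • x + y) (p - 1) x), hadPow]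
      change π (adPow br α (k • (x : G) + y) (p - 1) x) = _
      rw [hs k, map_sum]
      exact Finset.sum_congr rfl fun j _ => map_smul _ _ _
    · rw [← map_sum, ← hπ' (pmH (x + y)), ← hπ' (pmH x), ← hπ' (pmH y), ← map_add, ← map_add]
      exact congrArg π hsum
  · exact ⟨fun x y => Subtype.ext (hi.map_add x y), fun k x => Subtype.ext (hi.map_smul k x)⟩
  · exact fun x y hxy => hinj (congrArg Subtype.val hxy)
  · exact fun x y => Subtype.ext (hbr x y)
  · exact fun x => Subtype.ext (hα x)
  · intro K hKα hKbr hKpm hKi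
    have hle : H ≤ K.map H.subtype := by
      refine hHle _ ⟨?_, ?_, ?_⟩ fun x => ⟨_, hKi x, rfl⟩
      · rintro _ ⟨x, hx, rfl⟩
        exact ⟨_, hKα x hx, rfl⟩
      · rintro _ ⟨x, hx, rfl⟩ _ ⟨y, hy, rfl⟩
        exact ⟨_, hKbr x hx y hy, rfl⟩
      · rintro _ ⟨x, hx, rfl⟩
        exact ⟨_, hKpm x hx, rfl⟩
    rw [eq_top_iff]
    rintro ⟨x, hx⟩ -
    obtain ⟨y, hy, rfl⟩ := hle hx
    exact hy

/-- Compressing the operations of a `p`-envelope by an idempotent `π` fixing `L` whose kernel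
absorbs brackets with the twist-stable subspace `K` yields a `p`-envelope inside the range
of `π`. -/
lemma IsPEnvelope.exists_isPEnvelope_le_range (e : IsPEnvelope F p brL αL br α pm i)
    (hp : 1 < p) {K : Submodule F G} (hKα : ∀ x ∈ K, α x ∈ K) {π : G →ₗ[F] G}
    (hidem : ∀ x, π (π x) = π x) (himage : ∀ x, π (i x) = i x)
    (hker : LinearMap.ker π ≤ K) (hK : ∀ k ∈ K, ∀ x, π (br k x) = 0)
    (hcomm : ∀ x y, π (α (π (br x y))) = π (α (br x y))) :
    ∃ H ≤ LinearMap.range π, ∃ (brH : H → H → H) (αH pmH : H → H) (iH : L → H),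
      IsPEnvelope F p brL αL brH αH pmH iH := by
  have hsub : ∀ x, π x - x ∈ K := fun x =>
    hker (by rw [LinearMap.mem_ker, map_sub, hidem, sub_self])
  have hcongr : ∀ {x x' y y'}, x - x' ∈ K → y - y' ∈ K → π (br x y) = π (br x' y') := by
    intro x x' y y' hx hy
    have h1 := hK _ hx y
    have h2 := hK _ hy x'
    rw [e.1.sub_left, map_sub, sub_eq_zero] at h1
    rw [e.1.skew, map_neg, neg_eq_zero, e.1.sub_right, map_sub, sub_eq_zero] at h2
    rw [h1, h2]
  have hself : ∀ x, x - x ∈ K := fun x => by rw [sub_self]; exact K.zero_mem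
  let br' : G → G → G := fun x y => π (br x y)
  let α' : G → G := fun x => π (α x)
  have hiter : ∀ (n : ℕ) (x : G), α'^[n] x - α^[n] x ∈ K := by
    intro n x
    induction n with
    | zero => exact hself x
    | succ n ih =>
      rw [Function.iterate_succ_apply', Function.iterate_succ_apply']
      have h1 := K.add_mem (hsub (α (α'^[n] x))) (hKα _ ih)
      rw [e.1.alpha_linear.map_sub, sub_add_sub_cancel] at h1
      exact h1
  have hadPow : ∀ (n : ℕ) (x y : G), adPow br' α' x (n + 1) y = π (adPow br α x (n + 1) y) := by
    intro n x y
    induction n with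
    | zero => rfl
    | succ n ih =>
      rw [adPow_succ, ih, adPow_succ br]
      exact hcongr (hiter _ _) (hsub _)
  have h' : IsHomLie F br' α' :=
    { add_left := fun x y z => by simp only [br', e.1.add_left, map_add]
      smul_left := fun k x y => by simp only [br', e.1.smul_left, map_smul]
      add_right := fun x y z => by simp only [br', e.1.add_right, map_add]
      smul_right := fun k x y => by simp only [br', e.1.smul_right, map_smul]
      skew := fun x y => by simp only [br']; rw [e.1.skew, map_neg]
      alpha_linear := (π ∘ₗ e.1.twist).isLinear
      jacobi := fun x y z => by
        simp only [br', α']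
        rw [hcongr (hsub (α x)) (hsub (br y z)), hcongr (hsub (α y)) (hsub (br z x)),
          hcongr (hsub (α z)) (hsub (br x y)), ← map_add, ← map_add, e.1.jacobi, map_zero] }
  have hpm' : IsPStructureOn F p br' α' Set.univ fun x => π (pm x) := by
    refine ⟨fun _ _ => trivial, fun x _ y _ => ?_, fun x _ k => ?_, fun x _ y _ => ?_⟩
    · obtain ⟨n, rfl⟩ : ∃ n, p = n + 1 := ⟨p - 1, by omega⟩
      rw [hadPow, ← e.2.2.1.2.1 x trivial y trivial]
      exact hcongr (hsub _) (hiter _ _)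
    · exact (congrArg π (e.2.2.1.2.2.1 x trivial k)).trans (map_smul _ _ _)
    · obtain ⟨s, -, hs, hsum⟩ := e.2.2.1.2.2.2 x trivial y trivial
      refine ⟨fun j => π (s j), fun _ _ => trivial, fun k => ?_, ?_⟩
      · obtain ⟨n, hn⟩ : ∃ n, p - 1 = n + 1 := ⟨p - 2, by omega⟩
        have hsk := hs k
        rw [hn] at hsk ⊢
        rw [hadPow, hsk, map_sum]
        exact Finset.sum_congr rfl fun j _ => map_smul _ _ _
      · simp only [hsum, map_add, map_sum]
  refine exists_isPEnvelope_le h' (fun x y => ?_) hpm' e.2.2.2.1 e.2.2.2.2.1 (fun x y => ?_)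
    (fun x => ?_) ⟨?_, ?_, ?_⟩ fun x => ⟨i x, himage x⟩
  · simp only [br', α']
    rw [hcomm, e.2.1]
    exact (hcongr (hsub _) (hsub _)).symm
  · simp only [br', ← e.2.2.2.2.2.1, himage]
  · simp only [α', ← e.2.2.2.2.2.2.1, himage]
  · exact fun x _ => ⟨_, rfl⟩
  · exact fun x _ y _ => ⟨_, rfl⟩
  · exact fun x _ => ⟨_, rfl⟩

/-- In a minimal `p`-envelope the centralizer of `L` lies in `L`. -/
lemma IsMinimalPEnvelope.centralizer_le [FiniteDimensional F G]
    (hmin : IsMinimalPEnvelope F p brL αL br α pm i) (hp : 1 < p)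
    (hinv : ∀ x, αL (αL x) = x) (g : G)
    (hg : ∀ z ∈ hmin.1.image, br g z = 0) : g ∈ hmin.1.image := by
  have e := hmin.1
  change ∀ z ∈ e.image, br g z = 0 at hg
  change g ∈ e.image
  obtain ⟨n, -, himage, hbr, hcent⟩ := e.exists_fitting (by omega) hinv
  let K : Submodule F G := e.1.transporter e.image ⊥
  have hK : ∀ {k}, k ∈ K ↔ ∀ z ∈ e.image, br k z = 0 := Iff.rfl
  let N : Submodule F G := LinearMap.ker (e.1.twist ^ n)
  have hN : ∀ {x}, x ∈ N ↔ α^[n] x = 0 := by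
    intro x
    rw [LinearMap.mem_ker, e.1.twist_pow_apply]
  have hαzero : ∀ m, α^[m] 0 = 0 := fun m => by rw [← e.1.twist_pow_apply, map_zero]
  have hNK : N ≤ K := by
    intro x hx
    rw [hK]
    intro z hz
    refine himage _ (e.bracket_mem_image (by omega) hinv x z hz) ?_
    rw [e.2.1.iterate, hN.1 hx, e.1.zero_left]
  have hNα : ∀ x ∈ N, α x ∈ N := by
    intro x hx
    rw [hN, ← Function.iterate_succ_apply, Function.iterate_succ_apply', hN.1 hx]
    exact hαzero 1
  have hKα : ∀ k ∈ K, α k ∈ K := by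
    intro k hk
    rw [hK] at hk ⊢
    intro z hz
    obtain ⟨w, hw, rfl⟩ := e.exists_twist_eq hinv z hz
    rw [← e.2.1, hk w hw]
    exact hαzero 1
  have hNL : Disjoint N e.image :=
    Submodule.disjoint_def.2 fun x hx hxL => himage x hxL (hN.1 hx)
  obtain ⟨W', hNW', hW'⟩ := (hNL.mono_right (inf_le_left (b := K))).exists_isCompl
  have hWL : Disjoint e.image (W' ⊓ K) := by
    rw [Submodule.disjoint_def]
    exact fun x hx hxW => Submodule.disjoint_def.1 hW'.disjoint x hxW.1 ⟨hx, hxW.2⟩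
  have hKle : K ≤ (W' ⊓ K) ⊔ e.image := by
    intro k hk
    obtain ⟨w, hw, l, hl, rfl⟩ := Submodule.mem_sup.1
      (hW'.sup_eq_top ▸ Submodule.mem_top : k ∈ W' ⊔ (e.image ⊓ K))
    refine Submodule.add_mem_sup ⟨hw, ?_⟩ hl.1
    simpa using K.sub_mem hk hl.2
  obtain ⟨V, hLV, hV⟩ := hWL.exists_isCompl
  have hπ : ∀ x, V.projection _ hV x = 0 ↔ x ∈ W' ⊓ K :=
    fun x => Submodule.projection_apply_eq_zero_iff hV
  have hNW : N ≤ W' ⊓ K := le_inf hNW' hNK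
  have hcomm : ∀ x y, α (br x y - V.projection _ hV (br x y)) ∈ N := by
    intro x y
    obtain ⟨l, hl, hlxy⟩ := exists_iterate_eq (e.exists_twist_eq hinv) n _ (hbr (α^[n] x) y)
    have hsub : br x y - l ∈ N := by
      rw [LinearMap.mem_ker, map_sub, e.1.twist_pow_apply, e.1.twist_pow_apply, hlxy,
        e.2.1.iterate, sub_self]
    have hproj := (hπ _).2 (hNW hsub)
    rw [map_sub, Submodule.projection_apply_of_mem_left hV (hLV hl), sub_eq_zero] at hproj
    rw [hproj]
    exact hNα _ hsub
  obtain ⟨H, hH, brH, αH, pmH, iH, eH⟩ := e.exists_isPEnvelope_le_range hp hKα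
    (π := V.projection _ hV)
    (fun x => Submodule.projection_apply_of_mem_left hV (Submodule.projection_apply_mem hV x))
    (fun x => Submodule.projection_apply_of_mem_left hV (hLV ⟨x, rfl⟩))
    (fun x hx => ((hπ x).1 hx).2) (fun k hk x => (hπ _).2 (hNW (hN.2 (hcent k hk x))))
    (fun x y => by
      have h := (hπ _).2 (hNW (hcomm x y))
      rw [e.1.alpha_linear.map_sub, map_sub, sub_eq_zero] at h
      exact h.symm)
  have hrank := (hmin.2 H brH αH pmH iH eH).trans (Submodule.rank_mono hH)
  rw [Submodule.range_projection] at hrank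
  have hVtop : V = ⊤ := Submodule.eq_top_of_finrank_eq
    (le_antisymm V.finrank_le (Cardinal.toNat_le_toNat hrank (Module.rank_lt_aleph0 F V)))
  have hW : W' ⊓ K = ⊥ := by
    rw [hVtop] at hV
    exact eq_bot_iff.2 fun x hx => hV.disjoint.le_bot ⟨trivial, hx⟩
  rw [hW, bot_sup_eq] at hKle
  exact hKle hg

end Envelope

/-- A finite-dimensional `p`-envelope `(G, i)` of a finite-dimensional involutive Hom-Lie
algebra `L` is minimal iff the `α_G^(p-1)`-center of `G` is contained in `i(L)`. -/
theorem pEnvelope_minimal_iff_center_le {F : Type*} [Field F]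
    {L : Type v} {G : Type u}
    [AddCommGroup L] [Module F L] [AddCommGroup G] [Module F G]
    (p : ℕ) (hp : p.Prime) [CharP F p]
    (brL : L → L → L) (αL : L → L)
    (hHL : IsHomLie F brL αL) (hM : IsMult brL αL) (hinv : ∀ x : L, αL (αL x) = x)
    [FiniteDimensional F L] [FiniteDimensional F G]
    (brG : G → G → G) (αG : G → G) (pmG : G → G) (i : L → G)
    (henv : IsPEnvelope F p brL αL brG αG pmG i) :
    IsMinimalPEnvelope F p brL αL brG αG pmG i ↔
      ∀ x : G, (∀ y : G, brG x (αG^[p - 1] y) = 0) → x ∈ Set.range i := by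
  constructor
  · intro hmin x hx
    refine hmin.centralizer_le hp.one_lt hinv x ?_
    rintro z hz
    obtain ⟨w, -, rfl⟩ := exists_iterate_eq (henv.exists_twist_eq hinv) (p - 1) z hz
    exact hx w
  · intro hC
    exact ⟨henv, fun G' _ _ brG' αG' pm' i' e' => henv.rank_le e' hp.pos hinv
      (henv.centralizer_le_of_center_le hp.one_lt hinv hC)⟩
end HomLiePaper
end
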